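/- arXiv:2203.16233 — 2 statements merged into one kernel-verified Lean document; each statement's English description precedes it below -/
import Mathlib

section
/- Under Assumptions 1 and 2, for each i the reconstruction satisfies Σ_{j=1}^p ∂x̂_{ij}/∂x_{ij} = k + Σ_{j=1}^p tr{(I_p − P_k) h_{ij} e_j'} + Σ_{j=1}^p e_j' A_{ij} {x_i − t(F_n)}, where A_{ij} := Σ_{ℓ=1}^k Σ_{m=k+1}^p (1/(s_ℓ − s_m)) (T_ℓ H_{ij} T_m + T_m H_{ij} T_ℓ). -/
open Matrix Filter Finset

/-- `P` is the orthogonal projection onto the span of eigenvectors of `A` corresponding to its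
`k` largest eigenvalues, where `A` has `p` distinct eigenvalues. -/
def IsTopProj (p k : ℕ) (A P : Matrix (Fin p) (Fin p) ℝ) : Prop :=
  ∃ (u : Fin p → Fin p → ℝ) (s : Fin p → ℝ),
    (∀ a b, u a ⬝ᵥ u b = if a = b then (1 : ℝ) else 0) ∧ StrictAnti s ∧
    (∀ ℓ, A.mulVec (u ℓ) = s ℓ • u ℓ) ∧
    P = ∑ ℓ ∈ Finset.univ.filter (fun ℓ : Fin p => (ℓ : ℕ) < k), Matrix.vecMulVec (u ℓ) (u ℓ)

open Classical in
/-- The orthogonal projection onto the span of eigenvectors of `A` corresponding to its `k`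
largest eigenvalues (well defined whenever the eigenvalues of `A` are distinct). -/
noncomputable def topProj (p k : ℕ) (A : Matrix (Fin p) (Fin p) ℝ) :
    Matrix (Fin p) (Fin p) ℝ :=
  if h : ∃ P, IsTopProj p k A P then h.choose else 0

/-- The perturbed sample `F_{n,i,j,ε}`, in which `x i` is replaced by `x i + ε • e j`. -/
noncomputable def perturb (n p : ℕ) (X : Fin n → Fin p → ℝ) (i : Fin n) (j : Fin p) (ε : ℝ) :
    Fin n → Fin p → ℝ :=
  Function.update X i (X i + ε • (Pi.single j 1 : Fin p → ℝ))

/-- `u` is an orthonormal family of eigenvectors of `A` with eigenvalues `s`. -/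
def IsEigensystem {p : ℕ} (A : Matrix (Fin p) (Fin p) ℝ) (u : Fin p → Fin p → ℝ)
    (s : Fin p → ℝ) : Prop :=
  (∀ a b, u a ⬝ᵥ u b = if a = b then (1 : ℝ) else 0) ∧ ∀ ℓ, A.mulVec (u ℓ) = s ℓ • u ℓ

/-- The sum of the rank-one matrices `u ℓ (u ℓ)'` over `ℓ < k`. -/
def headProj {p : ℕ} (k : ℕ) (u : Fin p → Fin p → ℝ) : Matrix (Fin p) (Fin p) ℝ :=
  ∑ ℓ ∈ Finset.univ.filter (fun ℓ : Fin p => (ℓ : ℕ) < k), Matrix.vecMulVec (u ℓ) (u ℓ)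

section Eigensystem

variable {p : ℕ}

theorem exists_antitone_eigensystem {A : Matrix (Fin p) (Fin p) ℝ} (hA : A.IsSymm) :
    ∃ u s, Antitone s ∧ IsEigensystem A u s := by
  have hH : A.IsHermitian := by
    rw [Matrix.IsHermitian, Matrix.conjTranspose_eq_transpose_of_trivial]; exact hA
  set τ := Tuple.sort (fun i => -hH.eigenvalues i)
  have hτ : Monotone ((fun i => -hH.eigenvalues i) ∘ τ) := Tuple.monotone_sort _
  refine ⟨fun i => (hH.eigenvectorBasis (τ i)).ofLp, fun i => hH.eigenvalues (τ i),
    fun i j hij => neg_le_neg_iff.mp (hτ hij), fun a b => ?_,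
    fun ℓ => hH.mulVec_eigenvectorBasis (τ ℓ)⟩
  have := hH.eigenvectorBasis.inner_eq_ite (τ b) (τ a)
  rw [EuclideanSpace.inner_eq_star_dotProduct] at this
  simpa [eq_comm] using this

theorem mul_transpose_of_orthonormal {u : Fin p → Fin p → ℝ}
    (hu : ∀ a b, u a ⬝ᵥ u b = if a = b then (1 : ℝ) else 0) :
    Matrix.of u * (Matrix.of u)ᵀ = 1 := by
  ext a b
  simpa [Matrix.mul_apply, dotProduct, Matrix.one_apply] using hu a b

theorem eq_sum_dotProduct_smul {u : Fin p → Fin p → ℝ}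
    (hu : ∀ a b, u a ⬝ᵥ u b = if a = b then (1 : ℝ) else 0) (v : Fin p → ℝ) :
    v = ∑ m, (u m ⬝ᵥ v) • u m := by
  have h1 : (Matrix.of u)ᵀ * Matrix.of u = 1 := mul_eq_one_comm.mp (mul_transpose_of_orthonormal hu)
  have h2 : v = (Matrix.of u)ᵀ *ᵥ (Matrix.of u *ᵥ v) := by
    rw [Matrix.mulVec_mulVec, h1, Matrix.one_mulVec]
  conv_lhs => rw [h2]
  ext b
  simp [Matrix.mulVec, dotProduct, mul_comm]

theorem dotProduct_mulVec_comm {A : Matrix (Fin p) (Fin p) ℝ} (hA : A.IsSymm)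
    (v w : Fin p → ℝ) : v ⬝ᵥ A.mulVec w = A.mulVec v ⬝ᵥ w := by
  rw [Matrix.dotProduct_mulVec, ← Matrix.mulVec_transpose, hA]

/-- An antitone eigensystem of a symmetric matrix with distinct eigenvalues is unique up to
signs. -/
theorem IsEigensystem.unique {A : Matrix (Fin p) (Fin p) ℝ} (hA : A.IsSymm)
    {u v : Fin p → Fin p → ℝ} {s r : Fin p → ℝ} (hu : IsEigensystem A u s) (hs : StrictAnti s)
    (hv : IsEigensystem A v r) (hr : Antitone r) :
    r = s ∧ ∀ ℓ, Matrix.vecMulVec (v ℓ) (v ℓ) = Matrix.vecMulVec (u ℓ) (u ℓ) := by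
  have orth (m l) (h : s m ≠ r l) : u m ⬝ᵥ v l = 0 := by
    have := dotProduct_mulVec_comm hA (u m) (v l)
    rw [hv.2, hu.2, dotProduct_smul, smul_dotProduct, smul_eq_mul, smul_eq_mul] at this
    rcases mul_eq_zero.mp (show (s m - r l) * (u m ⬝ᵥ v l) = 0 by linarith) with h' | h'
    · exact absurd (sub_eq_zero.mp h') h
    · exact h'
  have ex (l) : ∃ m, s m = r l := by
    by_contra! hne
    have h0 : v l = 0 := by
      rw [eq_sum_dotProduct_smul hu.1 (v l)]
      exact Finset.sum_eq_zero fun m _ => by rw [orth m l (hne m), zero_smul]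
    simpa [h0] using hv.1 l l
  choose σ hσ using ex
  have par (l) : v l = (u (σ l) ⬝ᵥ v l) • u (σ l) := by
    conv_lhs => rw [eq_sum_dotProduct_smul hu.1 (v l)]
    refine Finset.sum_eq_single _ (fun m _ hm => ?_) (by simp)
    rw [orth m l fun h => hm (hs.injective (h.trans (hσ l).symm)), zero_smul]
  have sq (l) : (u (σ l) ⬝ᵥ v l) * (u (σ l) ⬝ᵥ v l) = 1 := by
    have := hv.1 l l
    rw [if_pos rfl] at this
    rw [par l, smul_dotProduct, dotProduct_smul, hu.1, if_pos rfl] at this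
    simpa using this
  have inj : Function.Injective σ := by
    intro l m hlm
    by_contra hne
    have h0 := hv.1 l m
    rw [if_neg hne, par l, par m, ← hlm] at h0
    simp only [smul_dotProduct, dotProduct_smul, hu.1, if_true, smul_eq_mul, mul_one] at h0
    have h1 := sq l
    have h2 := sq m
    rw [← hlm] at h2
    rcases mul_eq_zero.mp h0 with h | h
    · rw [h] at h2; simp at h2
    · rw [h] at h1; simp at h1
  have mono : StrictMono σ := by
    refine Monotone.strictMono_of_injective (fun l m hlm => ?_) inj
    rw [← hs.le_iff_ge, hσ, hσ]
    exact hr hlm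
  have hid : σ = id := (mono.range_inj strictMono_id).mp
    (by rw [(Finite.injective_iff_surjective.mp inj).range_eq, Set.range_id])
  subst hid
  refine ⟨funext fun l => (hσ l).symm, fun l => ?_⟩
  rw [par l, Matrix.smul_vecMulVec, Matrix.vecMulVec_smul, smul_smul]
  exact (congrArg (· • _) (sq l)).trans (one_smul _ _)

theorem topProj_eq_headProj {k : ℕ} {A : Matrix (Fin p) (Fin p) ℝ} (hA : A.IsSymm)
    {u : Fin p → Fin p → ℝ} {s : Fin p → ℝ} (hu : IsEigensystem A u s) (hs : StrictAnti s) :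
    topProj p k A = headProj k u := by
  have hex : ∃ P, IsTopProj p k A P := ⟨_, u, s, hu.1, hs, hu.2, rfl⟩
  obtain ⟨v, r, hv, hr, hvr, hP⟩ := hex.choose_spec
  rw [topProj, dif_pos hex, hP, headProj]
  exact Finset.sum_congr rfl fun ℓ _ => (hu.unique hA hs ⟨hv, hvr⟩ hr.antitone).2 ℓ

theorem isCompact_setOf_orthonormal :
    IsCompact {u : Fin p → Fin p → ℝ | ∀ a b, u a ⬝ᵥ u b = if a = b then (1 : ℝ) else 0} := by
  refine Metric.isCompact_of_isClosed_isBounded ?_ ?_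
  · simp only [Set.ofPred_forall]
    refine isClosed_iInter fun a => isClosed_iInter fun b => isClosed_eq ?_ continuous_const
    unfold dotProduct
    fun_prop
  · refine (Metric.isBounded_closedBall (x := 0) (r := 1)).subset fun u hu => ?_
    rw [mem_closedBall_zero_iff, pi_norm_le_iff_of_nonneg zero_le_one]
    refine fun a => (pi_norm_le_iff_of_nonneg zero_le_one).mpr fun b => ?_
    have h1 : u a b * u a b ≤ u a ⬝ᵥ u a :=
      Finset.single_le_sum (f := fun b => u a b * u a b) (fun _ _ => mul_self_nonneg _)
        (Finset.mem_univ b)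
    rw [hu a a, if_pos rfl] at h1
    rw [Real.norm_eq_abs, abs_le]
    constructor <;> nlinarith

theorem continuous_headProj (k : ℕ) :
    Continuous (headProj k : (Fin p → Fin p → ℝ) → Matrix (Fin p) (Fin p) ℝ) := by
  unfold headProj
  refine continuous_finsetSum _ fun ℓ _ => continuous_pi fun a => continuous_pi fun b => ?_
  simp only [Matrix.vecMulVec_apply]
  fun_prop

theorem IsEigensystem.eigenvalue_eq {A : Matrix (Fin p) (Fin p) ℝ} {u : Fin p → Fin p → ℝ}
    {s : Fin p → ℝ} (hu : IsEigensystem A u s) (ℓ : Fin p) : s ℓ = u ℓ ⬝ᵥ A.mulVec (u ℓ) := by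
  rw [hu.2, dotProduct_smul, hu.1]; simp

/-- Antitone eigensystems depend continuously on the matrix, at a matrix with distinct
eigenvalues. -/
theorem tendsto_eigensystem {ι : Type*} {l : Filter ι} {k : ℕ}
    {B : ι → Matrix (Fin p) (Fin p) ℝ} {A : Matrix (Fin p) (Fin p) ℝ} (hA : A.IsSymm)
    {u : Fin p → Fin p → ℝ} {s : Fin p → ℝ} (hu : IsEigensystem A u s) (hs : StrictAnti s)
    (hB : Tendsto B l (nhds A)) {v : ι → Fin p → Fin p → ℝ} {r : ι → Fin p → ℝ}
    (hv : ∀ i, IsEigensystem (B i) (v i) (r i)) (hr : ∀ i, Antitone (r i)) :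
    Tendsto r l (nhds s) ∧ Tendsto (fun i => headProj k (v i)) l (nhds (headProj k u)) := by
  have key (g : Ultrafilter ι) (hg : ↑g ≤ l) : Tendsto r g (nhds s) ∧
      Tendsto (fun i => headProj k (v i)) g (nhds (headProj k u)) := by
    obtain ⟨w, hw, hgw⟩ := isCompact_setOf_orthonormal.ultrafilter_le_nhds (g.map v)
      (by
        rw [Filter.le_principal_iff]
        exact Filter.mem_map.mpr (Filter.univ_mem' fun i => (hv i).1))
    have hvw : Tendsto v g (nhds w) := hgw
    have hBg : Tendsto B g (nhds A) := hB.mono_left hg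
    have hvl (ℓ) : Tendsto (fun i => v i ℓ) g (nhds (w ℓ)) := (tendsto_pi_nhds.mp hvw) ℓ
    have hBv (ℓ) : Tendsto (fun i => (B i).mulVec (v i ℓ)) g (nhds (A.mulVec (w ℓ))) :=
      ((continuous_fst.matrix_mulVec continuous_snd).tendsto (A, w ℓ)).comp
        (hBg.prodMk_nhds (hvl ℓ))
    have hrt : Tendsto r g (nhds fun ℓ => w ℓ ⬝ᵥ A.mulVec (w ℓ)) := by
      refine tendsto_pi_nhds.mpr fun ℓ => ?_
      simp only [fun i => (hv i).eigenvalue_eq ℓ]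
      exact ((continuous_fst.dotProduct continuous_snd).tendsto (w ℓ, A.mulVec (w ℓ))).comp
        ((hvl ℓ).prodMk_nhds (hBv ℓ))
    have hwe : IsEigensystem A w fun ℓ => w ℓ ⬝ᵥ A.mulVec (w ℓ) := by
      refine ⟨hw, fun ℓ => tendsto_nhds_unique (hBv ℓ) ?_⟩
      simp only [fun i => (hv i).2 ℓ]
      exact (tendsto_pi_nhds.mp hrt ℓ).smul (hvl ℓ)
    have hwa : Antitone fun ℓ => w ℓ ⬝ᵥ A.mulVec (w ℓ) := fun a b hab =>
      le_of_tendsto_of_tendsto' (tendsto_pi_nhds.mp hrt b) (tendsto_pi_nhds.mp hrt a)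
        fun i => hr i hab
    obtain ⟨h1, h2⟩ := hu.unique hA hs hwe hwa
    refine ⟨h1 ▸ hrt, ?_⟩
    have : headProj k u = headProj k w := Finset.sum_congr rfl fun ℓ _ => (h2 ℓ).symm
    rw [this]
    exact ((continuous_headProj k).tendsto w).comp hvw
  exact ⟨(tendsto_iff_ultrafilter _ _ _).mpr fun g hg => (key g hg).1,
    (tendsto_iff_ultrafilter _ _ _).mpr fun g hg => (key g hg).2⟩

theorem headProj_mulVec {k : ℕ} {u : Fin p → Fin p → ℝ}
    (hu : ∀ a b, u a ⬝ᵥ u b = if a = b then (1 : ℝ) else 0) (ℓ : Fin p) :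
    (headProj k u).mulVec (u ℓ) = (if (ℓ : ℕ) < k then (1 : ℝ) else 0) • u ℓ := by
  simp [headProj, Matrix.sum_mulVec, Matrix.vecMulVec_mulVec, hu, ite_smul]

theorem ext_mulVec_orthonormal {u : Fin p → Fin p → ℝ}
    (hu : ∀ a b, u a ⬝ᵥ u b = if a = b then (1 : ℝ) else 0)
    {M N : Matrix (Fin p) (Fin p) ℝ} (h : ∀ ℓ, M.mulVec (u ℓ) = N.mulVec (u ℓ)) : M = N := by
  refine Matrix.ext_iff_mulVec.mpr fun v => ?_
  rw [eq_sum_dotProduct_smul hu v]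
  simp [Matrix.mulVec_sum, Matrix.mulVec_smul, h]

theorem headProj_mul_self {k : ℕ} {u : Fin p → Fin p → ℝ}
    (hu : ∀ a b, u a ⬝ᵥ u b = if a = b then (1 : ℝ) else 0) :
    headProj k u * headProj k u = headProj k u := by
  refine ext_mulVec_orthonormal hu fun ℓ => ?_
  rw [← Matrix.mulVec_mulVec, headProj_mulVec hu, Matrix.mulVec_smul, headProj_mulVec hu, smul_smul]
  split_ifs <;> simp

theorem IsEigensystem.commute_headProj {k : ℕ} {A : Matrix (Fin p) (Fin p) ℝ}
    {u : Fin p → Fin p → ℝ} {s : Fin p → ℝ} (hu : IsEigensystem A u s) :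
    A * headProj k u = headProj k u * A := by
  refine ext_mulVec_orthonormal hu.1 fun ℓ => ?_
  rw [← Matrix.mulVec_mulVec, ← Matrix.mulVec_mulVec, headProj_mulVec hu.1, hu.2,
    Matrix.mulVec_smul, Matrix.mulVec_smul, headProj_mulVec hu.1, hu.2, smul_comm]

/-- First-order expansion of an idempotent commuting with a perturbation of a diagonal matrix
with distinct entries. -/
theorem tendsto_smul_idempotent_sub {ι : Type*} {l : Filter ι} {c : ι → ℝ}
    {B P : ι → Matrix (Fin p) (Fin p) ℝ} {χ s : Fin p → ℝ} {K : Matrix (Fin p) (Fin p) ℝ}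
    (hs : Function.Injective s) (hχ : ∀ a, χ a * χ a = χ a)
    (hcomm : ∀ i, B i * P i = P i * B i) (hidem : ∀ i, P i * P i = P i)
    (hP : Tendsto P l (nhds (Matrix.diagonal χ)))
    (hB : Tendsto (fun i => c i • (B i - Matrix.diagonal s)) l (nhds K)) :
    Tendsto (fun i => c i • (P i - Matrix.diagonal χ)) l
      (nhds (Matrix.of fun a b => (χ a - χ b) * (s a - s b)⁻¹ * K a b)) := by
  set G := fun i => c i • (B i - Matrix.diagonal s) with hG
  set Q := fun i => c i • (P i - Matrix.diagonal χ) with hQ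
  have hcommQ (i) : Matrix.diagonal s * Q i - Q i * Matrix.diagonal s = P i * G i - G i * P i := by
    have hd : Matrix.diagonal s * Matrix.diagonal χ = Matrix.diagonal χ * Matrix.diagonal s := by
      simp [Matrix.diagonal_mul_diagonal, mul_comm]
    simp only [hG, hQ, Matrix.mul_smul, Matrix.smul_mul, ← smul_sub, Matrix.mul_sub,
      Matrix.sub_mul, hcomm, hd]
    congr 1
    abel
  have hidemQ (i) : Q i = P i * Q i + Q i * Matrix.diagonal χ := by
    have hd : Matrix.diagonal χ * Matrix.diagonal χ = Matrix.diagonal χ := by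
      simp [Matrix.diagonal_mul_diagonal, hχ]
    simp only [hQ, Matrix.mul_smul, Matrix.smul_mul, ← smul_add, Matrix.mul_sub,
      Matrix.sub_mul, hidem, hd]
    congr 1
    abel
  have hlim : Tendsto (fun i => P i * G i - G i * P i) l
      (nhds (Matrix.diagonal χ * K - K * Matrix.diagonal χ)) := (hP.mul hB).sub (hB.mul hP)
  have off (a b) (hab : a ≠ b) :
      Tendsto (fun i => Q i a b) l (nhds ((χ a - χ b) * (s a - s b)⁻¹ * K a b)) := by
    have hne : s a - s b ≠ 0 := sub_ne_zero.mpr fun h => hab (hs h)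
    have h1 := (tendsto_pi_nhds.mp (tendsto_pi_nhds.mp hlim a) b).const_mul (s a - s b)⁻¹
    simp only [← hcommQ] at h1
    simp only [Matrix.sub_apply, Matrix.diagonal_mul, Matrix.mul_diagonal] at h1
    refine (h1.congr fun i => ?_).trans_eq ?_
    · field_simp
    · congr 1; ring
  refine tendsto_pi_nhds.mpr fun a => tendsto_pi_nhds.mpr fun b => ?_
  rcases ne_or_eq a b with hab | rfl
  · exact off a b hab
  have hPe (b) : Tendsto (fun i => P i a b) l (nhds (Matrix.diagonal χ a b)) :=
    tendsto_pi_nhds.mp (tendsto_pi_nhds.mp hP a) b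
  have hden : Tendsto (fun i => 1 - χ a - P i a a) l (nhds (1 - χ a - χ a)) := by
    simpa using tendsto_const_nhds.sub (hPe a)
  have hne : 1 - χ a - χ a ≠ 0 := by
    intro h
    nlinarith [hχ a]
  have hnum : Tendsto (fun i => ∑ b ∈ Finset.univ.erase a, P i a b * Q i b a) l (nhds 0) := by
    rw [show (0 : ℝ) = ∑ b ∈ Finset.univ.erase a,
      Matrix.diagonal χ a b * ((χ b - χ a) * (s b - s a)⁻¹ * K b a) from
        (Finset.sum_eq_zero fun b hb => by
          rw [Matrix.diagonal_apply_ne _ (Finset.ne_of_mem_erase hb).symm, zero_mul]).symm]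
    exact tendsto_finsetSum _ fun b hb => (hPe b).mul (off b a (Finset.ne_of_mem_erase hb))
  have hq := hnum.div hden hne
  simp only [Matrix.of_apply, sub_self, zero_mul]
  rw [zero_div] at hq
  refine hq.congr' ?_
  filter_upwards [hden.eventually_ne hne] with i hi
  have h1 := congrFun (congrFun (hidemQ i) a) a
  rw [Matrix.add_apply, Matrix.mul_diagonal, Matrix.mul_apply,
    ← Finset.add_sum_erase _ _ (Finset.mem_univ a)] at h1
  rw [Pi.div_apply, div_eq_iff hi]
  change _ = Q i a a * _
  linarith

theorem conj_apply (u : Fin p → Fin p → ℝ) (M : Matrix (Fin p) (Fin p) ℝ) (a b : Fin p) :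
    (Matrix.of u * M * (Matrix.of u)ᵀ) a b = u a ⬝ᵥ M.mulVec (u b) := by
  rw [Matrix.mul_assoc, Matrix.mul_apply, dotProduct]
  simp [Matrix.mul_apply, Matrix.mulVec, dotProduct]

theorem conj_eq_diagonal {u : Fin p → Fin p → ℝ}
    (hu : ∀ a b, u a ⬝ᵥ u b = if a = b then (1 : ℝ) else 0) {M : Matrix (Fin p) (Fin p) ℝ}
    {d : Fin p → ℝ} (hM : ∀ ℓ, M.mulVec (u ℓ) = d ℓ • u ℓ) :
    Matrix.of u * M * (Matrix.of u)ᵀ = Matrix.diagonal d := by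
  ext a b
  rw [conj_apply, hM, dotProduct_smul, hu, Matrix.diagonal_apply]
  split_ifs with hab <;> simp [hab]

/-- The derivative of the projection onto the top `k` eigenvectors in the direction `H`. -/
noncomputable def headProjDeriv (k : ℕ) (u : Fin p → Fin p → ℝ) (s : Fin p → ℝ)
    (H : Matrix (Fin p) (Fin p) ℝ) : Matrix (Fin p) (Fin p) ℝ :=
  ∑ a ∈ Finset.univ.filter (fun a : Fin p => (a : ℕ) < k),
    ∑ b ∈ Finset.univ.filter (fun b : Fin p => k ≤ (b : ℕ)),
      (s a - s b)⁻¹ • (Matrix.vecMulVec (u a) (u a) * H * Matrix.vecMulVec (u b) (u b)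
        + Matrix.vecMulVec (u b) (u b) * H * Matrix.vecMulVec (u a) (u a))

theorem dotProduct_vecMulVec_mul_mul_mulVec {u : Fin p → Fin p → ℝ}
    (hu : ∀ a b, u a ⬝ᵥ u b = if a = b then (1 : ℝ) else 0) (H : Matrix (Fin p) (Fin p) ℝ)
    (a b c d : Fin p) :
    u c ⬝ᵥ (Matrix.vecMulVec (u a) (u a) * H * Matrix.vecMulVec (u b) (u b)).mulVec (u d) =
      if c = a then if d = b then u c ⬝ᵥ H.mulVec (u d) else 0 else 0 := by
  rw [← Matrix.mulVec_mulVec, ← Matrix.mulVec_mulVec, Matrix.vecMulVec_mulVec]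
  simp only [op_smul_eq_smul, Matrix.mulVec_smul, dotProduct_smul,
    Matrix.vecMulVec_mulVec, hu]
  split_ifs <;> simp_all

theorem conj_headProjDeriv {k : ℕ} {u : Fin p → Fin p → ℝ}
    (hu : ∀ a b, u a ⬝ᵥ u b = if a = b then (1 : ℝ) else 0) (s : Fin p → ℝ)
    (H : Matrix (Fin p) (Fin p) ℝ) :
    Matrix.of u * headProjDeriv k u s H * (Matrix.of u)ᵀ = Matrix.of fun a b : Fin p =>
      ((if (a : ℕ) < k then (1 : ℝ) else 0) - if (b : ℕ) < k then (1 : ℝ) else 0) *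
        (s a - s b)⁻¹ * (Matrix.of u * H * (Matrix.of u)ᵀ) a b := by
  ext c d
  rw [conj_apply, Matrix.of_apply, conj_apply, headProjDeriv]
  simp only [Matrix.sum_mulVec, dotProduct_sum, Matrix.smul_mulVec, dotProduct_smul,
    Matrix.add_mulVec, dotProduct_add, dotProduct_vecMulVec_mul_mul_mulVec hu, smul_add,
    Finset.sum_add_distrib, smul_eq_mul, mul_ite, mul_zero, Finset.sum_ite_irrel,
    Finset.sum_const_zero, Finset.sum_ite_eq, Finset.mem_filter, Finset.mem_univ, true_and]
  have hneg : (s d - s c)⁻¹ = -(s c - s d)⁻¹ := by rw [← inv_neg, neg_sub]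
  by_cases hc : (c : ℕ) < k <;> by_cases hd : (d : ℕ) < k <;>
    simp [hc, hd, not_le.mpr, not_lt.mp, hneg]

/-- Differentiability of the projection onto the top `k` eigenvectors along a path of symmetric
matrices. -/
theorem tendsto_smul_topProj_sub {ι : Type*} {l : Filter ι} {k : ℕ} {c : ι → ℝ}
    {B : ι → Matrix (Fin p) (Fin p) ℝ} {A H : Matrix (Fin p) (Fin p) ℝ}
    (hA : A.IsSymm) (hBs : ∀ i, (B i).IsSymm) {u : Fin p → Fin p → ℝ} {s : Fin p → ℝ}
    (hu : IsEigensystem A u s) (hs : StrictAnti s) (hB : Tendsto B l (nhds A))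
    (hH : Tendsto (fun i => c i • (B i - A)) l (nhds H)) :
    Tendsto (fun i => c i • (topProj p k (B i) - headProj k u)) l
      (nhds (headProjDeriv k u s H)) := by
  choose v r hr hv using fun i => exists_antitone_eigensystem (hBs i)
  obtain ⟨hrs, hPt⟩ := tendsto_eigensystem (k := k) hA hu hs hB hv hr
  have hstrict : ∀ᶠ i in l, StrictAnti (r i) := by
    have : ∀ᶠ i in l, ∀ a b : Fin p, a < b → r i b < r i a := by
      simp only [Filter.eventually_all]
      exact fun a b hab => (tendsto_pi_nhds.mp hrs b).eventually_lt (tendsto_pi_nhds.mp hrs a)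
        (hs hab)
    exact this.mono fun i hi a b => hi a b
  set W : Matrix (Fin p) (Fin p) ℝ := Matrix.of u
  have h1 : W * Wᵀ = 1 := mul_transpose_of_orthonormal hu.1
  have h2 : Wᵀ * W = 1 := mul_eq_one_comm.mp h1
  have conj_mul (M N : Matrix (Fin p) (Fin p) ℝ) :
      W * M * Wᵀ * (W * N * Wᵀ) = W * (M * N) * Wᵀ := by
    rw [show W * M * Wᵀ * (W * N * Wᵀ) = W * M * (Wᵀ * W) * N * Wᵀ by noncomm_ring, h2]
    noncomm_ring
  have unconj (M : Matrix (Fin p) (Fin p) ℝ) : Wᵀ * (W * M * Wᵀ) * W = M := by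
    rw [show Wᵀ * (W * M * Wᵀ) * W = (Wᵀ * W) * M * (Wᵀ * W) by noncomm_ring, h2]
    simp
  have hconj {f : ι → Matrix (Fin p) (Fin p) ℝ} {M} (V : Matrix (Fin p) (Fin p) ℝ)
      (V' : Matrix (Fin p) (Fin p) ℝ) (hf : Tendsto f l (nhds M)) :
      Tendsto (fun i => V * f i * V') l (nhds (V * M * V')) :=
    (tendsto_const_nhds.mul hf).mul tendsto_const_nhds
  have hW : W * headProj k u * Wᵀ = _ := conj_eq_diagonal hu.1 (headProj_mulVec (k := k) hu.1)
  have hWA : W * A * Wᵀ = _ := conj_eq_diagonal hu.1 hu.2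
  have hmain := tendsto_smul_idempotent_sub (c := c) (B := fun i => W * B i * Wᵀ)
    (P := fun i => W * headProj k (v i) * Wᵀ) (K := W * H * Wᵀ) (l := l) hs.injective
    (χ := fun ℓ : Fin p => if (ℓ : ℕ) < k then (1 : ℝ) else 0) (by intro a; split_ifs <;> simp)
    (fun i => by simp only [conj_mul, (hv i).commute_headProj])
    (fun i => by simp only [conj_mul, headProj_mul_self (hv i).1])
    (hW ▸ hconj W Wᵀ hPt)
    ((hconj W Wᵀ hH).congr fun i => by
      rw [← hWA, Matrix.mul_smul, Matrix.smul_mul, Matrix.mul_sub, Matrix.sub_mul])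
  rw [← conj_headProjDeriv hu.1, ← hW] at hmain
  have hfin := hconj Wᵀ W hmain
  change Tendsto _ l (nhds (Wᵀ * (W * headProjDeriv k u s H * Wᵀ) * W)) at hfin
  rw [unconj] at hfin
  refine hfin.congr' ?_
  filter_upwards [hstrict] with i hi
  rw [topProj_eq_headProj (hBs i) (hv i) hi, Matrix.mul_smul, Matrix.smul_mul, ← Matrix.sub_mul,
    ← Matrix.mul_sub, unconj]

theorem trace_headProj {k : ℕ} (hk : k ≤ p) {u : Fin p → Fin p → ℝ}
    (hu : ∀ a b, u a ⬝ᵥ u b = if a = b then (1 : ℝ) else 0) :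
    (headProj k u).trace = k := by
  simp [headProj, Matrix.trace_sum, Matrix.trace_vecMulVec, hu, Fin.card_filter_val_lt, hk]

end Eigensystem

/-- Under Assumptions 1 and 2, for each `i` the reconstruction satisfies
`∑ⱼ ∂x̂ᵢⱼ/∂xᵢⱼ = k + ∑ⱼ tr{(I_p − P_k) h_ij e_j'} + ∑ⱼ e_j' A_ij (x_i − t(F_n))`, where
`A_ij = ∑_{ℓ ≤ k} ∑_{m > k} (s_ℓ − s_m)⁻¹ (T_ℓ H_ij T_m + T_m H_ij T_ℓ)` and
`∂x̂ᵢⱼ/∂xᵢⱼ` is the derivative at `ε = 0` of the `j`-th coordinate of the reconstruction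
`x̂ᵢ(ε) = t(F_{n,i,j,ε}) + P_k(ε){xᵢ + ε eⱼ − t(F_{n,i,j,ε})}`. -/
theorem stmt_3 (n p k : ℕ) (hk1 : 1 ≤ k) (hkp : k < p)
    (x : Fin n → Fin p → ℝ)
    (tfun : (Fin n → Fin p → ℝ) → (Fin p → ℝ))
    (Sfun : (Fin n → Fin p → ℝ) → Matrix (Fin p) (Fin p) ℝ)
    (hSsymm : ∀ X, (Sfun X).IsSymm) (hSpsd : ∀ X, (Sfun X).PosSemidef)
    (h : Fin n → Fin p → (Fin p → ℝ)) (H : Fin n → Fin p → Matrix (Fin p) (Fin p) ℝ)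
    (hHsymm : ∀ i j, (H i j).IsSymm)
    -- Assumption 1:
    (hA1t : ∀ i j, Tendsto (fun ε : ℝ => ε⁻¹ • (tfun (perturb n p x i j ε) - tfun x))
      (nhdsWithin 0 {0}ᶜ) (nhds (h i j)))
    (hA1S : ∀ i j, Tendsto (fun ε : ℝ => ε⁻¹ • (Sfun (perturb n p x i j ε) - Sfun x))
      (nhdsWithin 0 {0}ᶜ) (nhds (H i j)))
    -- Assumption 2: the eigenvalues `s 0 > ⋯ > s (p-1)` of `S(F_n)` are distinct,
    -- with orthonormal eigenvectors `u` and eigenprojections `T ℓ = u ℓ (u ℓ)'`: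
    (u : Fin p → Fin p → ℝ) (s : Fin p → ℝ)
    (hortho : ∀ a b, u a ⬝ᵥ u b = if a = b then (1 : ℝ) else 0)
    (hanti : StrictAnti s)
    (heig : ∀ ℓ, (Sfun x).mulVec (u ℓ) = s ℓ • u ℓ)
    (T : Fin p → Matrix (Fin p) (Fin p) ℝ) (hT : ∀ ℓ, T ℓ = Matrix.vecMulVec (u ℓ) (u ℓ))
    (Pk : Matrix (Fin p) (Fin p) ℝ)
    (hPk : Pk = ∑ ℓ ∈ Finset.univ.filter (fun ℓ : Fin p => (ℓ : ℕ) < k), T ℓ)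
    (A : Fin n → Fin p → Matrix (Fin p) (Fin p) ℝ)
    (hA : ∀ i j, A i j = ∑ a ∈ Finset.univ.filter (fun a : Fin p => (a : ℕ) < k),
        ∑ b ∈ Finset.univ.filter (fun b : Fin p => k ≤ (b : ℕ)),
          (s a - s b)⁻¹ • (T a * H i j * T b + T b * H i j * T a))
    (i : Fin n) :
    (∀ j : Fin p, DifferentiableAt ℝ
        (fun ε : ℝ => (tfun (perturb n p x i j ε)
          + (topProj p k (Sfun (perturb n p x i j ε))).mulVec
              (x i + ε • (Pi.single j 1 : Fin p → ℝ) - tfun (perturb n p x i j ε))) j) 0)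
    ∧ ∑ j : Fin p,
        deriv (fun ε : ℝ => (tfun (perturb n p x i j ε)
          + (topProj p k (Sfun (perturb n p x i j ε))).mulVec
              (x i + ε • (Pi.single j 1 : Fin p → ℝ) - tfun (perturb n p x i j ε))) j) 0
      = (k : ℝ)
        + ∑ j : Fin p, Matrix.trace
            ((1 - Pk) * Matrix.vecMulVec (h i j) (Pi.single j 1 : Fin p → ℝ))
        + ∑ j : Fin p, ((A i j).mulVec (x i - tfun x)) j := by
  have hu : IsEigensystem (Sfun x) u s := ⟨hortho, heig⟩
  have hPk' : Pk = headProj k u := by simp only [hPk, hT, headProj]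
  have hA' (j) : A i j = headProjDeriv k u s (H i j) := by simp only [hA, hT, headProjDeriv]
  have hx (j) : perturb n p x i j 0 = x := by simp [perturb]
  have dt (j b) : HasDerivAt (fun ε => tfun (perturb n p x i j ε) b) (h i j b) 0 := by
    rw [hasDerivAt_iff_tendsto_slope_zero]
    simpa [hx] using tendsto_pi_nhds.mp (hA1t i j) b
  have hcont (j) : Tendsto (fun ε => Sfun (perturb n p x i j ε)) (nhdsWithin 0 {0}ᶜ)
      (nhds (Sfun x)) := by
    refine tendsto_pi_nhds.mpr fun a => tendsto_pi_nhds.mpr fun b => ?_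
    have hd : HasDerivAt (fun ε => Sfun (perturb n p x i j ε) a b) (H i j a b) 0 := by
      rw [hasDerivAt_iff_tendsto_slope_zero]
      simpa [hx] using tendsto_pi_nhds.mp (tendsto_pi_nhds.mp (hA1S i j) a) b
    simpa [hx] using hd.continuousAt.tendsto.mono_left nhdsWithin_le_nhds
  have dP (j a b) : HasDerivAt (fun ε => topProj p k (Sfun (perturb n p x i j ε)) a b)
      (A i j a b) 0 := by
    rw [hasDerivAt_iff_tendsto_slope_zero, hA']
    have := tendsto_smul_topProj_sub (k := k) (hSsymm x) (fun ε => hSsymm _) hu hanti (hcont j)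
      (hA1S i j)
    simpa [hx, topProj_eq_headProj (hSsymm x) hu hanti] using
      tendsto_pi_nhds.mp (tendsto_pi_nhds.mp this a) b
  have hderiv (j) : HasDerivAt (fun ε : ℝ => (tfun (perturb n p x i j ε)
          + (topProj p k (Sfun (perturb n p x i j ε))).mulVec
              (x i + ε • (Pi.single j 1 : Fin p → ℝ) - tfun (perturb n p x i j ε))) j)
      (Pk j j + ((1 - Pk) * Matrix.vecMulVec (h i j) (Pi.single j 1 : Fin p → ℝ)).trace
        + ((A i j).mulVec (x i - tfun x)) j) 0 := by
    have hv (b) : HasDerivAt (fun ε : ℝ => x i b + ε * (Pi.single j 1 : Fin p → ℝ) b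
        - tfun (perturb n p x i j ε) b) ((Pi.single j 1 : Fin p → ℝ) b - h i j b) 0 := by
      simpa using (((hasDerivAt_id' (0 : ℝ)).mul_const
        ((Pi.single j 1 : Fin p → ℝ) b)).const_add (x i b)).fun_sub (dt j b)
    refine ((dt j j).add (HasDerivAt.fun_sum (u := Finset.univ)
      fun b _ => (dP j j b).mul (hv b))).congr_deriv ?_
    rw [hPk']
    simp only [zero_mul, add_zero]
    simp only [hx, topProj_eq_headProj (hSsymm x) hu hanti, Matrix.mul_vecMulVec,
      Matrix.trace_vecMulVec, Matrix.sub_mulVec, Matrix.one_mulVec,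
      Pi.sub_apply, Matrix.mulVec, dotProduct, mul_sub,
      Finset.sum_add_distrib, Finset.sum_sub_distrib, Pi.single_apply, mul_ite, mul_one, mul_zero,
      Finset.sum_ite_eq', Finset.mem_univ, if_true]
    ring
  refine ⟨fun j => (hderiv j).differentiableAt, ?_⟩
  rw [Finset.sum_congr rfl fun j _ => (hderiv j).deriv, Finset.sum_add_distrib,
    Finset.sum_add_distrib, ← trace_headProj hkp.le hortho, ← hPk']
  rfl
end

section
/- Under Assumptions 1 and 2, for each i, j the perturbed reconstruction x̂_i(ε) = t(F_{n,i,j,ε}) + P_k(ε){x_i + ε e_j − t(F_{n,i,j,ε})} is differentiable at ε = 0 with derivative h_{ij} + P_k(e_j − h_{ij}) + A_{ij}{x_i − t(F_n)}, where A_{ij} := Σ_{ℓ=1}^k Σ_{m=k+1}^p (1/(s_ℓ − s_m)) (T_ℓ H_{ij} T_m + T_m H_{ij} T_ℓ). -/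
open Matrix Filter Finset

/-- The diagonal matrix whose first `k` diagonal entries are `1` and whose others are `0`. -/
def topDiag (p k : ℕ) : Matrix (Fin p) (Fin p) ℝ :=
  diagonal fun c => if (c : ℕ) < k then 1 else 0

theorem topDiag_mul_self (p k : ℕ) : topDiag p k * topDiag p k = topDiag p k := by
  rw [topDiag, diagonal_mul_diagonal]
  congr 1
  ext c
  split_ifs <;> simp

theorem of_mul_transpose_eq_one {p : ℕ} {v : Fin p → Fin p → ℝ}
    (hv : ∀ a b, v a ⬝ᵥ v b = if a = b then (1 : ℝ) else 0) :
    Matrix.of v * (Matrix.of v)ᵀ = 1 := by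
  ext a b
  rw [one_apply, ← hv a b]
  rfl

theorem transpose_mul_topDiag_mul {p : ℕ} (k : ℕ) (v : Fin p → Fin p → ℝ) :
    (Matrix.of v)ᵀ * topDiag p k * Matrix.of v =
      ∑ ℓ ∈ Finset.univ.filter (fun ℓ : Fin p => (ℓ : ℕ) < k), vecMulVec (v ℓ) (v ℓ) := by
  ext a b
  rw [Matrix.sum_apply, Finset.sum_filter, topDiag, Matrix.mul_apply]
  refine Finset.sum_congr rfl fun c _ => ?_
  rw [mul_diagonal, vecMulVec_apply]
  split_ifs <;> simp

theorem eq_transpose_mul_diagonal_mul {p : ℕ} {A : Matrix (Fin p) (Fin p) ℝ}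
    {v : Fin p → Fin p → ℝ} {s : Fin p → ℝ}
    (hv : ∀ a b, v a ⬝ᵥ v b = if a = b then (1 : ℝ) else 0)
    (hA : ∀ ℓ, A.mulVec (v ℓ) = s ℓ • v ℓ) :
    A = (Matrix.of v)ᵀ * diagonal s * Matrix.of v := by
  have h1 : A * (Matrix.of v)ᵀ = (Matrix.of v)ᵀ * diagonal s := by
    ext a b
    rw [mul_diagonal]
    have := congrFun (hA b) a
    rw [Pi.smul_apply, smul_eq_mul, mul_comm] at this
    exact this
  rw [← h1, Matrix.mul_assoc, mul_eq_one_comm.mp (of_mul_transpose_eq_one hv), Matrix.mul_one]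

theorem isTopProj_iff {p k : ℕ} {A P : Matrix (Fin p) (Fin p) ℝ} :
    IsTopProj p k A P ↔ ∃ (V : Matrix (Fin p) (Fin p) ℝ) (s : Fin p → ℝ),
      V * Vᵀ = 1 ∧ StrictAnti s ∧ A = Vᵀ * diagonal s * V ∧ P = Vᵀ * topDiag p k * V := by
  constructor
  · rintro ⟨v, s, hv, hs, hA, rfl⟩
    exact ⟨Matrix.of v, s, of_mul_transpose_eq_one hv, hs, eq_transpose_mul_diagonal_mul hv hA,
      (transpose_mul_topDiag_mul k v).symm⟩
  · rintro ⟨V, s, hV, hs, rfl, rfl⟩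
    refine ⟨fun c => V c, s, fun a b => ?_, hs, fun ℓ => ?_, transpose_mul_topDiag_mul k _⟩
    · rw [← one_apply, ← hV]
      rfl
    · have h1 : Vᵀ * diagonal s * V * Vᵀ = Vᵀ * diagonal s := by
        rw [Matrix.mul_assoc, hV, Matrix.mul_one]
      ext a
      have := congrFun (congrFun h1 a) ℓ
      rw [mul_diagonal, mul_comm] at this
      exact this

theorem isTopProj_topProj {p k : ℕ} {A P : Matrix (Fin p) (Fin p) ℝ} (h : IsTopProj p k A P) :
    IsTopProj p k A (topProj p k A) := by
  have h' : ∃ P, IsTopProj p k A P := ⟨P, h⟩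
  rw [topProj, dif_pos h']
  exact h'.choose_spec

namespace IsTopProj

variable {p k : ℕ} {A P : Matrix (Fin p) (Fin p) ℝ}

theorem isSymm (h : IsTopProj p k A P) : P.IsSymm := by
  obtain ⟨V, s, -, -, -, rfl⟩ := isTopProj_iff.mp h
  rw [Matrix.IsSymm, transpose_mul, transpose_mul, transpose_transpose, topDiag,
    diagonal_transpose, Matrix.mul_assoc]

theorem mul_self (h : IsTopProj p k A P) : P * P = P := by
  obtain ⟨V, s, hV, -, -, rfl⟩ := isTopProj_iff.mp h
  calc Vᵀ * topDiag p k * V * (Vᵀ * topDiag p k * V)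
      = Vᵀ * topDiag p k * (V * Vᵀ) * topDiag p k * V := by simp only [Matrix.mul_assoc]
    _ = Vᵀ * (topDiag p k * topDiag p k) * V := by
        rw [hV, Matrix.mul_one]; simp only [Matrix.mul_assoc]
    _ = Vᵀ * topDiag p k * V := by rw [topDiag_mul_self]

theorem mul_comm (h : IsTopProj p k A P) : A * P = P * A := by
  obtain ⟨V, s, hV, -, rfl, rfl⟩ := isTopProj_iff.mp h
  have key (X Y : Matrix (Fin p) (Fin p) ℝ) :
      Vᵀ * X * V * (Vᵀ * Y * V) = Vᵀ * (X * Y) * V := by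
    calc Vᵀ * X * V * (Vᵀ * Y * V) = Vᵀ * X * (V * Vᵀ) * Y * V := by
          simp only [Matrix.mul_assoc]
      _ = Vᵀ * (X * Y) * V := by rw [hV, Matrix.mul_one]; simp only [Matrix.mul_assoc]
  rw [key, key, topDiag, (commute_diagonal s _).eq]

theorem conj (h : IsTopProj p k A P) {U : Matrix (Fin p) (Fin p) ℝ} (hU : U * Uᵀ = 1) :
    IsTopProj p k (U * A * Uᵀ) (U * P * Uᵀ) := by
  obtain ⟨V, s, hV, hs, rfl, rfl⟩ := isTopProj_iff.mp h
  refine isTopProj_iff.mpr ⟨V * Uᵀ, s, ?_, hs, ?_, ?_⟩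
  · rw [transpose_mul, transpose_transpose, Matrix.mul_assoc, ← Matrix.mul_assoc Uᵀ,
      mul_eq_one_comm.mp hU, Matrix.one_mul, hV]
  all_goals simp only [transpose_mul, transpose_transpose, Matrix.mul_assoc]

end IsTopProj

section Perturbation

variable {p : ℕ} {V : Matrix (Fin p) (Fin p) ℝ} {s : Fin p → ℝ}

theorem sum_sq_col_eq_one (hV : V * Vᵀ = 1) (a : Fin p) : ∑ c, V c a ^ 2 = 1 := by
  have h1 : Vᵀ * V = 1 := mul_eq_one_comm.mp hV
  have := congrFun (congrFun h1 a) a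
  rw [one_apply_eq, Matrix.mul_apply] at this
  simpa only [transpose_apply, sq] using this

theorem sum_sq_eigenvalue_sub_mul {l : Fin p → ℝ} (hV : V * Vᵀ = 1) (a : Fin p) :
    ∑ c, (l c - s a) ^ 2 * V c a ^ 2 =
      ∑ b, (Vᵀ * diagonal l * V - diagonal s) b a ^ 2 := by
  set D := Vᵀ * diagonal l * V - diagonal s with hD
  have h1 : V * D = diagonal l * V - V * diagonal s := by
    rw [hD, Matrix.mul_sub, Matrix.mul_assoc, ← Matrix.mul_assoc V, hV, Matrix.one_mul]
  have h2 : (V * D)ᵀ * (V * D) = Dᵀ * D := by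
    rw [transpose_mul, Matrix.mul_assoc, ← Matrix.mul_assoc Vᵀ, mul_eq_one_comm.mp hV,
      Matrix.one_mul]
  have h3 := congrFun (congrFun h2 a) a
  rw [Matrix.mul_apply, Matrix.mul_apply] at h3
  simp only [transpose_apply, ← sq] at h3
  rw [← h3, h1]
  refine Finset.sum_congr rfl fun c _ => ?_
  rw [Matrix.sub_apply, diagonal_mul, mul_diagonal]
  ring

theorem exists_abs_eigenvalue_sub_le {l : Fin p → ℝ} (hV : V * Vᵀ = 1) {r : ℝ} (hr : 0 ≤ r)
    (a : Fin p) (hD : ∑ b, (Vᵀ * diagonal l * V - diagonal s) b a ^ 2 ≤ r ^ 2) :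
    ∃ c, |l c - s a| ≤ r := by
  by_contra! hlt
  rw [← sum_sq_eigenvalue_sub_mul hV] at hD
  have hsq (c) : r ^ 2 < (l c - s a) ^ 2 := by
    rw [← sq_abs (l c - s a)]
    exact pow_lt_pow_left₀ (hlt c) hr two_ne_zero
  have h1 : ∑ c, ((l c - s a) ^ 2 - r ^ 2) * V c a ^ 2 ≤ 0 := by
    simp only [sub_mul, Finset.sum_sub_distrib, ← Finset.mul_sum, sum_sq_col_eq_one hV]
    linarith
  have hnn : ∀ c ∈ Finset.univ, 0 ≤ ((l c - s a) ^ 2 - r ^ 2) * V c a ^ 2 := fun c _ =>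
    mul_nonneg (sub_nonneg.mpr (hsq c).le) (sq_nonneg _)
  have h2 := (Finset.sum_eq_zero_iff_of_nonneg hnn).mp (le_antisymm h1 (Finset.sum_nonneg hnn))
  have h3 : ∑ c, V c a ^ 2 = 0 := Finset.sum_eq_zero fun c hc =>
    (mul_eq_zero.mp (h2 c hc)).resolve_left (sub_pos.mpr (hsq c)).ne'
  rw [sum_sq_col_eq_one hV] at h3
  exact one_ne_zero h3

/-- Near a matrix with well-separated eigenvalues, sorted eigenvalues stay close. -/
theorem abs_eigenvalue_sub_le {l : Fin p → ℝ} (hV : V * Vᵀ = 1) (hl : StrictAnti l) {r : ℝ}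
    (hr : 0 ≤ r) (hgap : ∀ a b, a < b → 2 * r < s a - s b)
    (hD : ∀ a, ∑ b, (Vᵀ * diagonal l * V - diagonal s) b a ^ 2 ≤ r ^ 2) (a : Fin p) :
    |l a - s a| ≤ r := by
  choose g hg using fun a => exists_abs_eigenvalue_sub_le hV hr a (hD a)
  have hmono : StrictMono g := fun a b hab => by
    have h1 := abs_le.mp (hg a)
    have h2 := abs_le.mp (hg b)
    have h3 := hgap a b hab
    exact hl.lt_iff_gt.mp (by linarith)
  have hid : g = id := by
    have := Subsingleton.elim (hmono.orderIsoOfSurjective g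
      (Finite.surjective_of_injective hmono.injective)) (OrderIso.refl (Fin p))
    ext1 a
    exact congrArg (fun e : Fin p ≃o Fin p => e a) this
  simpa [hid] using hg a

theorem exists_orthogonal_diagonalization {A : Matrix (Fin p) (Fin p) ℝ} (hA : A.IsSymm) :
    ∃ (V : Matrix (Fin p) (Fin p) ℝ) (l : Fin p → ℝ),
      V * Vᵀ = 1 ∧ A = Vᵀ * diagonal l * V := by
  have hH : A.IsHermitian := by rwa [Matrix.IsHermitian, conjTranspose_eq_transpose_of_trivial]
  have hv (a b : Fin p) :
      (hH.eigenvectorBasis a).ofLp ⬝ᵥ (hH.eigenvectorBasis b).ofLp =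
        if a = b then (1 : ℝ) else 0 := by
    have := orthonormal_iff_ite.mp hH.eigenvectorBasis.orthonormal b a
    simpa [PiLp.inner_apply, dotProduct, eq_comm] using this
  exact ⟨Matrix.of fun a => (hH.eigenvectorBasis a).ofLp, hH.eigenvalues,
    of_mul_transpose_eq_one hv, eq_transpose_mul_diagonal_mul hv hH.mulVec_eigenvectorBasis⟩

theorem exists_isTopProj {A : Matrix (Fin p) (Fin p) ℝ} (k : ℕ) (hA : A.IsSymm) {r : ℝ}
    (hr : 0 ≤ r) (hgap : ∀ a b, a < b → 2 * r < s a - s b)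
    (hD : ∀ a, ∑ b, (A - diagonal s) b a ^ 2 ≤ r ^ 2) :
    ∃ P, IsTopProj p k A P := by
  obtain ⟨V, l, hV, rfl⟩ := exists_orthogonal_diagonalization hA
  choose g hg using fun a => exists_abs_eigenvalue_sub_le hV hr a (hD a)
  have hanti : StrictAnti (l ∘ g) := fun a b hab => by
    have h1 := abs_le.mp (hg a)
    have h2 := abs_le.mp (hg b)
    have h3 := hgap a b hab
    simp only [Function.comp_apply]
    linarith
  have hinj : Function.Injective g := fun a b hab =>
    hanti.injective (congrArg l hab)
  let e : Fin p ≃ Fin p := Equiv.ofBijective g (Finite.injective_iff_bijective.mp hinj)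
  refine ⟨_, isTopProj_iff.mpr ⟨V.submatrix e id, l ∘ e, ?_, hanti, ?_, rfl⟩⟩
  · rw [transpose_submatrix, ← submatrix_mul _ _ e id e Function.bijective_id, hV,
      submatrix_one_equiv]
  · rw [← submatrix_diagonal_equiv, transpose_submatrix, submatrix_mul_equiv,
      submatrix_mul_equiv, submatrix_id_id]

theorem IsTopProj.abs_apply_self_sub_mul_le {k : ℕ} {A P : Matrix (Fin p) (Fin p) ℝ}
    (hP : IsTopProj p k A P) {r : ℝ}
    (hr : 0 ≤ r) (hgap : ∀ a b, a < b → 2 * r < s a - s b)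
    (hD : ∀ a, ∑ b, (A - diagonal s) b a ^ 2 ≤ r ^ 2) (a : Fin p) :
    |P a a - topDiag p k a a| * r ^ 2 ≤ ∑ b, (A - diagonal s) b a ^ 2 := by
  obtain ⟨V, l, hV, hl, rfl, rfl⟩ := isTopProj_iff.mp hP
  have hnear := abs_eigenvalue_sub_le hV hl hr hgap hD
  have hfar (c : Fin p) (hc : c ≠ a) : r ^ 2 ≤ (l c - s a) ^ 2 := by
    rw [← sq_abs (l c - s a)]
    refine pow_le_pow_left₀ hr ?_ 2
    have h1 := abs_le.mp (hnear c)
    rcases hc.lt_or_gt with h | h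
    · exact le_abs.mpr (.inl (by linarith [hgap c a h]))
    · exact le_abs.mpr (.inr (by linarith [hgap a c h]))
  have hdiag : (Vᵀ * topDiag p k * V) a a = ∑ c, topDiag p k c c * V c a ^ 2 := by
    rw [Matrix.mul_apply]
    refine Finset.sum_congr rfl fun c _ => ?_
    rw [topDiag, mul_diagonal, transpose_apply, diagonal_apply_eq]
    ring
  have hsub : (Vᵀ * topDiag p k * V) a a - topDiag p k a a =
      ∑ c, (topDiag p k c c - topDiag p k a a) * V c a ^ 2 := by
    simp only [sub_mul, Finset.sum_sub_distrib, ← Finset.mul_sum, sum_sq_col_eq_one hV, hdiag,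
      mul_one]
  rw [hsub, ← sum_sq_eigenvalue_sub_mul hV]
  refine (mul_le_mul_of_nonneg_right (Finset.abs_sum_le_sum_abs _ _) (sq_nonneg r)).trans ?_
  rw [Finset.sum_mul]
  refine Finset.sum_le_sum fun c _ => ?_
  rw [abs_mul, abs_of_nonneg (sq_nonneg (V c a))]
  by_cases hc : c = a
  · subst hc
    simp only [sub_self, abs_zero, zero_mul]
    positivity
  · have h1 : |topDiag p k c c - topDiag p k a a| ≤ 1 := by
      simp only [topDiag, diagonal_apply_eq]
      split_ifs <;> simp
    calc |topDiag p k c c - topDiag p k a a| * V c a ^ 2 * r ^ 2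
        ≤ 1 * V c a ^ 2 * r ^ 2 := by gcongr
      _ = r ^ 2 * V c a ^ 2 := by ring
      _ ≤ (l c - s a) ^ 2 * V c a ^ 2 :=
        mul_le_mul_of_nonneg_right (hfar c hc) (sq_nonneg _)

theorem exists_gap (hs : StrictAnti s) : ∃ r, 0 < r ∧ ∀ a b, a < b → 2 * r < s a - s b := by
  have : ∀ᶠ r : ℝ in nhdsWithin 0 (Set.Ioi 0), ∀ a b, a < b → 2 * r < s a - s b := by
    refine Filter.Eventually.filter_mono nhdsWithin_le_nhds ?_
    refine eventually_all.mpr fun a => eventually_all.mpr fun b => ?_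
    by_cases hab : a < b
    · have hc : Continuous fun r : ℝ => 2 * r := by fun_prop
      filter_upwards [(hc.tendsto 0).eventually_lt_const
        (by simpa using hs hab : 2 * (0 : ℝ) < s a - s b)] with r hr _ using hr
    · exact Eventually.of_forall fun r h => absurd h hab
  obtain ⟨r, hr, h0⟩ := (this.and self_mem_nhdsWithin).exists
  exact ⟨r, h0, hr⟩

end Perturbation

theorem IsTopProj.apply_self {p k : ℕ} {A P : Matrix (Fin p) (Fin p) ℝ}
    (h : IsTopProj p k A P) (a : Fin p) : P a a = ∑ c, P a c ^ 2 := by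
  conv_lhs => rw [← h.mul_self, Matrix.mul_apply]
  refine Finset.sum_congr rfl fun c _ => ?_
  rw [h.isSymm.apply, sq]

theorem IsTopProj.abs_apply_le_one {p k : ℕ} {A P : Matrix (Fin p) (Fin p) ℝ}
    (h : IsTopProj p k A P) (a b : Fin p) : |P a b| ≤ 1 := by
  have h2 (c : Fin p) : P a c ^ 2 ≤ P a a := by
    rw [h.apply_self]
    exact Finset.single_le_sum (f := fun c => P a c ^ 2) (fun c _ => sq_nonneg _)
      (Finset.mem_univ c)
  rw [← sq_le_one_iff_abs_le_one]
  nlinarith [h2 a, h2 b]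

theorem IsTopProj.apply_eq {p k : ℕ} {A P : Matrix (Fin p) (Fin p) ℝ} {s : Fin p → ℝ}
    (h : IsTopProj p k A P) {a b : Fin p} (hab : s a - s b ≠ 0) :
    P a b = (s a - s b)⁻¹ * ∑ c, (P a c * (A - diagonal s) c b - P c b * (A - diagonal s) a c) := by
  have h1 : diagonal s * P - P * diagonal s = P * (A - diagonal s) - (A - diagonal s) * P := by
    rw [Matrix.mul_sub, Matrix.sub_mul, h.mul_comm]
    abel
  have h2 := congrFun (congrFun h1 a) b
  rw [Matrix.sub_apply, Matrix.sub_apply, diagonal_mul, mul_diagonal, Matrix.mul_apply, Matrix.mul_apply,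
    ← Finset.sum_sub_distrib] at h2
  rw [eq_inv_mul_iff_mul_eq₀ hab, sub_mul, _root_.mul_comm (s b), h2]
  exact Finset.sum_congr rfl fun c _ => by ring

theorem hasDerivAt_mul_of_continuousAt {f g : ℝ → ℝ} {g' x : ℝ} (hf : ContinuousAt f x)
    (hg : HasDerivAt g g' x) (hx : g x = 0) :
    HasDerivAt (fun y => f y * g y) (f x * g') x := by
  rw [hasDerivAt_iff_tendsto_slope] at hg ⊢
  refine ((hf.tendsto.mono_left nhdsWithin_le_nhds).mul hg).congr fun y => ?_
  simp only [slope_def_field, hx]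
  ring

section Derivative

variable {p k : ℕ} {N P : ℝ → Matrix (Fin p) (Fin p) ℝ} {s : Fin p → ℝ}
  {K : Matrix (Fin p) (Fin p) ℝ}

theorem eventually_sum_sq_le (hN0 : N 0 = diagonal s)
    (hN : ∀ a b, ContinuousAt (fun ε => N ε a b) 0) {r : ℝ} (hr : 0 < r) :
    ∀ᶠ ε in nhds (0 : ℝ), ∀ a, ∑ b, (N ε - diagonal s) b a ^ 2 ≤ r ^ 2 := by
  refine eventually_all.mpr fun a => ?_
  have hc : ContinuousAt (fun ε => ∑ b, (N ε - diagonal s) b a ^ 2) 0 := by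
    refine tendsto_finsetSum _ fun b _ => ContinuousAt.pow ?_ 2
    simp only [Matrix.sub_apply]
    exact (hN b a).sub continuousAt_const
  refine hc.tendsto.eventually_le_const ?_
  simp only [hN0, sub_self, Matrix.zero_apply]
  simpa using pow_pos hr 2

theorem eventually_exists_isTopProj (hs : StrictAnti s) (hN0 : N 0 = diagonal s)
    (hsymm : ∀ ε, (N ε).IsSymm) (hN : ∀ a b, ContinuousAt (fun ε => N ε a b) 0) :
    ∀ᶠ ε in nhds (0 : ℝ), ∃ Q, IsTopProj p k (N ε) Q := by
  obtain ⟨r, hr, hgap⟩ := exists_gap hs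
  filter_upwards [eventually_sum_sq_le hN0 hN hr] with ε hε
  exact exists_isTopProj k (hsymm ε) hr.le hgap hε

theorem tendsto_of_isTopProj (hs : StrictAnti s) (hN0 : N 0 = diagonal s)
    (hN : ∀ a b, ContinuousAt (fun ε => N ε a b) 0)
    (hP : ∀ᶠ ε in nhds (0 : ℝ), IsTopProj p k (N ε) (P ε)) (a b : Fin p) :
    Tendsto (fun ε => P ε a b) (nhds 0) (nhds (topDiag p k a b)) := by
  have hD (a b) : Tendsto (fun ε => (N ε - diagonal s) a b) (nhds 0) (nhds 0) := by
    have := (hN a b).tendsto.sub_const (diagonal s a b)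
    rwa [hN0, sub_self] at this
  by_cases hab : a = b
  · subst hab
    obtain ⟨r, hr, hgap⟩ := exists_gap hs
    have hsum : Tendsto (fun ε => (∑ b, (N ε - diagonal s) b a ^ 2) / r ^ 2) (nhds 0)
        (nhds 0) := by
      have := (tendsto_finsetSum Finset.univ fun b _ => (hD b a).pow 2).div_const (r ^ 2)
      simpa using this
    rw [tendsto_iff_dist_tendsto_zero]
    refine squeeze_zero' (Eventually.of_forall fun ε => dist_nonneg) ?_ hsum
    filter_upwards [hP, eventually_sum_sq_le hN0 hN hr] with ε h1 h2
    rw [Real.dist_eq, le_div_iff₀ (pow_pos hr 2)]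
    exact h1.abs_apply_self_sub_mul_le hr.le hgap h2 a
  · have hne : s a - s b ≠ 0 := sub_ne_zero.mpr (hs.injective.ne hab)
    have hbdd (a b) (c d) :
        Tendsto (fun ε => P ε a b * (N ε - diagonal s) c d) (nhds 0) (nhds 0) := by
      refine bdd_le_mul_tendsto_zero' 1 ?_ (hD c d)
      filter_upwards [hP] with ε h using h.abs_apply_le_one a b
    have hlim := (tendsto_finsetSum Finset.univ fun c _ =>
      (hbdd a c c b).sub (hbdd c b a c)).const_mul (s a - s b)⁻¹
    rw [topDiag, diagonal_apply_ne _ hab]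
    simp only [sub_zero, Finset.sum_const_zero, mul_zero] at hlim
    refine hlim.congr' ?_
    filter_upwards [hP] with ε h using (h.apply_eq hne).symm

/-- The derivative of the top projection at a diagonal matrix with entries `s`, in direction
`K`. -/
noncomputable def topProjDeriv (p k : ℕ) (s : Fin p → ℝ) (K : Matrix (Fin p) (Fin p) ℝ) :
    Matrix (Fin p) (Fin p) ℝ :=
  Matrix.of fun a b => (s a - s b)⁻¹ * ((topDiag p k a a - topDiag p k b b) * K a b)

theorem hasDerivAt_of_isTopProj (hs : StrictAnti s) (hN0 : N 0 = diagonal s)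
    (hN : ∀ a b, HasDerivAt (fun ε => N ε a b) (K a b) 0)
    (hP : ∀ᶠ ε in nhds (0 : ℝ), IsTopProj p k (N ε) (P ε)) (a b : Fin p) :
    HasDerivAt (fun ε => P ε a b) (topProjDeriv p k s K a b) 0 := by
  have hlim := tendsto_of_isTopProj hs hN0 (fun a b => (hN a b).continuousAt) hP
  have hP0 (a b) : P 0 a b = topDiag p k a b :=
    tendsto_nhds_unique (tendsto_pure_nhds (fun ε => P ε a b) 0)
      ((hlim a b).mono_left (pure_le_nhds 0))
  have hcont (a b) : ContinuousAt (fun ε => P ε a b) 0 := by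
    rw [ContinuousAt, hP0]
    exact hlim a b
  have hD (a b) : HasDerivAt (fun ε => (N ε - diagonal s) a b) (K a b) 0 :=
    (hN a b).sub_const _
  have hD0 (a b) : (N 0 - diagonal s) a b = 0 := by rw [hN0, sub_self, Matrix.zero_apply]
  have hoff (a b) (hab : a ≠ b) :
      HasDerivAt (fun ε => P ε a b) (topProjDeriv p k s K a b) 0 := by
    have hne : s a - s b ≠ 0 := sub_ne_zero.mpr (hs.injective.ne hab)
    have hd := (HasDerivAt.fun_sum (u := Finset.univ) fun c _ =>
      (hasDerivAt_mul_of_continuousAt (hcont a c) (hD c b) (hD0 c b)).fun_sub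
        (hasDerivAt_mul_of_continuousAt (hcont c b) (hD a c) (hD0 a c))).const_mul (s a - s b)⁻¹
    refine (hd.congr_deriv ?_).congr_of_eventuallyEq ?_
    · simp only [topProjDeriv, of_apply, hP0, Finset.sum_sub_distrib]
      simp only [topDiag, diagonal_apply, ite_mul, zero_mul, Finset.sum_ite_eq,
        Finset.sum_ite_eq', Finset.mem_univ, if_true, sub_mul]
    · filter_upwards [hP] with ε h using h.apply_eq hne
  by_cases hab : a = b
  swap
  · exact hoff a b hab
  subst hab
  have hq : HasDerivAt (fun ε => ∑ c ∈ Finset.univ.erase a, P ε a c ^ 2) 0 0 := by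
    refine (HasDerivAt.fun_sum (u := Finset.univ.erase a) fun c hc =>
      (hoff a c (Finset.ne_of_mem_erase hc).symm).fun_pow 2).congr_deriv ?_
    refine Finset.sum_eq_zero fun c hc => ?_
    rw [hP0, topDiag, diagonal_apply_ne _ (Finset.ne_of_mem_erase hc).symm]
    simp
  have hq0 : ∑ c ∈ Finset.univ.erase a, P 0 a c ^ 2 = 0 := by
    refine Finset.sum_eq_zero fun c hc => ?_
    rw [hP0, topDiag, diagonal_apply_ne _ (Finset.ne_of_mem_erase hc).symm]
    simp
  have hidem : ∀ᶠ ε in nhds (0 : ℝ),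
      P ε a a * (1 - P ε a a) = ∑ c ∈ Finset.univ.erase a, P ε a c ^ 2 := by
    filter_upwards [hP] with ε h
    have h1 := h.apply_self a
    rw [← Finset.add_sum_erase _ _ (Finset.mem_univ a)] at h1
    linear_combination h1
  have hzero : topProjDeriv p k s K a a = 0 := by simp [topProjDeriv]
  rw [hzero]
  by_cases hak : (a : ℕ) < k
  · have h1 : P 0 a a = 1 := by rw [hP0, topDiag, diagonal_apply_eq, if_pos hak]
    have hne : P 0 a a ≠ 0 := by rw [h1]; exact one_ne_zero
    have hd := (hasDerivAt_mul_of_continuousAt ((hcont a a).inv₀ hne) hq hq0).const_sub 1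
    refine (hd.congr_deriv (by simp)).congr_of_eventuallyEq ?_
    filter_upwards [hidem, (hcont a a).eventually_ne hne] with ε h2 h3
    simp only [Pi.inv_apply]
    rw [← h2]
    field_simp
    ring
  · have h1 : P 0 a a = 0 := by rw [hP0, topDiag, diagonal_apply_eq, if_neg hak]
    have hc : ContinuousAt (fun ε => 1 - P ε a a) 0 := continuousAt_const.sub (hcont a a)
    have hne : 1 - P 0 a a ≠ 0 := by rw [h1, sub_zero]; exact one_ne_zero
    have hd := hasDerivAt_mul_of_continuousAt (hc.inv₀ hne) hq hq0
    refine (hd.congr_deriv (by simp)).congr_of_eventuallyEq ?_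
    filter_upwards [hidem, hc.eventually_ne hne] with ε h2 h3
    simp only [Pi.inv_apply]
    rw [← h2]
    field_simp

end Derivative

theorem hasDerivAt_conj {p : ℕ} {M : ℝ → Matrix (Fin p) (Fin p) ℝ}
    {K : Matrix (Fin p) (Fin p) ℝ} {x : ℝ} (hM : ∀ a b, HasDerivAt (fun ε => M ε a b) (K a b) x)
    (U W : Matrix (Fin p) (Fin p) ℝ) (a b : Fin p) :
    HasDerivAt (fun ε => (U * M ε * W) a b) ((U * K * W) a b) x := by
  simp only [Matrix.mul_apply]
  exact HasDerivAt.fun_sum fun c _ =>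
    (HasDerivAt.fun_sum fun d _ => (hM d c).const_mul _).mul_const _

theorem topProjDeriv_apply {p k : ℕ} {s : Fin p → ℝ} (K : Matrix (Fin p) (Fin p) ℝ)
    (a b : Fin p) : topProjDeriv p k s K a b =
      (if (a : ℕ) < k ∧ k ≤ (b : ℕ) then (s a - s b)⁻¹ * K a b else 0) +
        if (b : ℕ) < k ∧ k ≤ (a : ℕ) then (s b - s a)⁻¹ * K a b else 0 := by
  simp only [topProjDeriv, of_apply, topDiag, diagonal_apply_eq]
  by_cases ha : (a : ℕ) < k <;> by_cases hb : (b : ℕ) < k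
  · simp [ha, hb, ha.not_ge, hb.not_ge]
  · simp [ha, hb, ha.not_ge, not_lt.mp hb]
  · simp only [ha, hb, hb.not_ge, not_lt.mp ha, if_true, if_false, and_true, and_false, zero_add]
    rw [← neg_sub (s a) (s b), inv_neg]
    ring
  · simp [ha, hb]

theorem vecMulVec_mul_mul_vecMulVec {p : ℕ} (u : Fin p → Fin p → ℝ)
    (H : Matrix (Fin p) (Fin p) ℝ) (a b x y : Fin p) :
    (vecMulVec (u a) (u a) * H * vecMulVec (u b) (u b)) x y =
      u a x * (Matrix.of u * H * (Matrix.of u)ᵀ) a b * u b y := by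
  simp only [Matrix.mul_apply, vecMulVec_apply, transpose_apply, of_apply, Finset.mul_sum,
    Finset.sum_mul]
  exact Finset.sum_congr rfl fun d _ => Finset.sum_congr rfl fun c _ => by ring

theorem transpose_mul_topProjDeriv_mul {p k : ℕ} {s : Fin p → ℝ} (u : Fin p → Fin p → ℝ)
    (H : Matrix (Fin p) (Fin p) ℝ) :
    (Matrix.of u)ᵀ * topProjDeriv p k s (Matrix.of u * H * (Matrix.of u)ᵀ) * Matrix.of u =
      ∑ a ∈ Finset.univ.filter (fun a : Fin p => (a : ℕ) < k),
        ∑ b ∈ Finset.univ.filter (fun b : Fin p => k ≤ (b : ℕ)),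
          (s a - s b)⁻¹ • (vecMulVec (u a) (u a) * H * vecMulVec (u b) (u b) +
            vecMulVec (u b) (u b) * H * vecMulVec (u a) (u a)) := by
  ext x y
  set G := Matrix.of u * H * (Matrix.of u)ᵀ with hG
  let f (a b : Fin p) : ℝ :=
    if (a : ℕ) < k ∧ k ≤ (b : ℕ) then (s a - s b)⁻¹ * (u a x * G a b * u b y) else 0
  let g (a b : Fin p) : ℝ :=
    if (a : ℕ) < k ∧ k ≤ (b : ℕ) then (s a - s b)⁻¹ * (u b x * G b a * u a y) else 0
  have hl : ((Matrix.of u)ᵀ * topProjDeriv p k s G * Matrix.of u) x y =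
      ∑ b, ∑ a, (f a b + g b a) := by
    simp only [Matrix.mul_apply, topProjDeriv_apply, transpose_apply, of_apply, Finset.sum_mul]
    refine Finset.sum_congr rfl fun b _ => Finset.sum_congr rfl fun a _ => ?_
    simp only [f, g]
    split_ifs <;> ring
  rw [hl]
  simp only [Finset.sum_add_distrib]
  rw [Finset.sum_comm, ← Finset.sum_add_distrib]
  simp only [Matrix.sum_apply, Matrix.smul_apply, Matrix.add_apply, vecMulVec_mul_mul_vecMulVec, ← hG,
    smul_eq_mul]
  simp only [Finset.sum_filter]
  refine Finset.sum_congr rfl fun a _ => ?_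
  rw [← Finset.sum_add_distrib]
  by_cases ha : (a : ℕ) < k
  · rw [if_pos ha]
    refine Finset.sum_congr rfl fun b _ => ?_
    simp only [f, g, ha, true_and]
    split_ifs <;> ring
  · simp [f, g, ha]

theorem hasDerivAt_of_tendsto_inv_smul {f : ℝ → ℝ} {c f' : ℝ} (h0 : f 0 = c)
    (h : Tendsto (fun ε : ℝ => ε⁻¹ * (f ε - c)) (nhdsWithin 0 {0}ᶜ) (nhds f')) :
    HasDerivAt f f' 0 := by
  rw [hasDerivAt_iff_tendsto_slope]
  refine h.congr fun ε => ?_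
  rw [slope_def_field, h0, sub_zero, div_eq_inv_mul]

/-- The top projection of a differentiable curve of symmetric matrices is differentiable at a
point where the eigenvalues are distinct. -/
theorem hasDerivAt_topProj {p k : ℕ} {A : ℝ → Matrix (Fin p) (Fin p) ℝ}
    {H : Matrix (Fin p) (Fin p) ℝ} {u : Fin p → Fin p → ℝ} {s : Fin p → ℝ}
    (hsymm : ∀ ε, (A ε).IsSymm) (hA : ∀ a b, HasDerivAt (fun ε => A ε a b) (H a b) 0)
    (hu : ∀ a b, u a ⬝ᵥ u b = if a = b then (1 : ℝ) else 0) (hs : StrictAnti s)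
    (heig : ∀ ℓ, (A 0).mulVec (u ℓ) = s ℓ • u ℓ) :
    topProj p k (A 0) =
        ∑ ℓ ∈ Finset.univ.filter (fun ℓ : Fin p => (ℓ : ℕ) < k), vecMulVec (u ℓ) (u ℓ) ∧
      ∀ a b, HasDerivAt (fun ε => topProj p k (A ε) a b)
        ((∑ a ∈ Finset.univ.filter (fun a : Fin p => (a : ℕ) < k),
          ∑ b ∈ Finset.univ.filter (fun b : Fin p => k ≤ (b : ℕ)),
            (s a - s b)⁻¹ • (vecMulVec (u a) (u a) * H * vecMulVec (u b) (u b) +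
              vecMulVec (u b) (u b) * H * vecMulVec (u a) (u a))) a b) 0 := by
  set U := Matrix.of u with hUdef
  have hU : U * Uᵀ = 1 := of_mul_transpose_eq_one hu
  have hU' : Uᵀ * U = 1 := mul_eq_one_comm.mp hU
  have hcancel (M : Matrix (Fin p) (Fin p) ℝ) : Uᵀ * (U * M * Uᵀ) * U = M := by
    calc Uᵀ * (U * M * Uᵀ) * U = Uᵀ * U * M * (Uᵀ * U) := by simp only [Matrix.mul_assoc]
      _ = M := by rw [hU', Matrix.one_mul, Matrix.mul_one]
  have hN0 : U * A 0 * Uᵀ = diagonal s := by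
    rw [eq_transpose_mul_diagonal_mul hu heig, ← hUdef]
    calc U * (Uᵀ * diagonal s * U) * Uᵀ = U * Uᵀ * diagonal s * (U * Uᵀ) := by
          simp only [Matrix.mul_assoc]
      _ = diagonal s := by rw [hU, Matrix.one_mul, Matrix.mul_one]
  have hN := hasDerivAt_conj hA U Uᵀ
  have hNsymm (ε) : (U * A ε * Uᵀ).IsSymm := by
    rw [Matrix.IsSymm, transpose_mul, transpose_mul, transpose_transpose, (hsymm ε).eq,
      Matrix.mul_assoc]
  have hP : ∀ᶠ ε in nhds (0 : ℝ),
      IsTopProj p k (U * A ε * Uᵀ) (U * topProj p k (A ε) * Uᵀ) := by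
    filter_upwards [eventually_exists_isTopProj (k := k) hs hN0 hNsymm
      fun a b => (hN a b).continuousAt] with ε ⟨Q, hQ⟩
    have h1 := hQ.conj (U := Uᵀ) (by rwa [transpose_transpose])
    rw [transpose_transpose, hcancel] at h1
    exact (isTopProj_topProj h1).conj hU
  constructor
  · have h0 : U * topProj p k (A 0) * Uᵀ = topDiag p k := by
      ext a b
      exact tendsto_nhds_unique
        (tendsto_pure_nhds (fun ε => (U * topProj p k (A ε) * Uᵀ) a b) 0)
        ((tendsto_of_isTopProj hs hN0 (fun a b => (hN a b).continuousAt) hP a b).mono_left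
          (pure_le_nhds 0))
    rw [← hcancel (topProj p k (A 0)), h0, transpose_mul_topDiag_mul]
  · intro a b
    have := hasDerivAt_conj (hasDerivAt_of_isTopProj hs hN0 hN hP) Uᵀ U a b
    simpa only [hcancel, hUdef ▸ transpose_mul_topProjDeriv_mul u H] using this

/-- Under Assumptions 1 and 2, for each `i, j` the perturbed reconstruction
`x̂ᵢ(ε) = t(F_{n,i,j,ε}) + P_k(ε){xᵢ + ε eⱼ − t(F_{n,i,j,ε})}` is differentiable at `ε = 0`
with derivative `h_ij + P_k(e_j − h_ij) + A_ij(x_i − t(F_n))`, where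
`A_ij = ∑_{ℓ ≤ k} ∑_{m > k} (s_ℓ − s_m)⁻¹ (T_ℓ H_ij T_m + T_m H_ij T_ℓ)`. -/
theorem stmt_4 (n p k : ℕ) (hk1 : 1 ≤ k) (hkp : k < p)
    (x : Fin n → Fin p → ℝ)
    (tfun : (Fin n → Fin p → ℝ) → (Fin p → ℝ))
    (Sfun : (Fin n → Fin p → ℝ) → Matrix (Fin p) (Fin p) ℝ)
    (hSsymm : ∀ X, (Sfun X).IsSymm) (hSpsd : ∀ X, (Sfun X).PosSemidef)
    (h : Fin n → Fin p → (Fin p → ℝ)) (H : Fin n → Fin p → Matrix (Fin p) (Fin p) ℝ)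
    (hHsymm : ∀ i j, (H i j).IsSymm)
    -- Assumption 1:
    (hA1t : ∀ i j, Tendsto (fun ε : ℝ => ε⁻¹ • (tfun (perturb n p x i j ε) - tfun x))
      (nhdsWithin 0 {0}ᶜ) (nhds (h i j)))
    (hA1S : ∀ i j, Tendsto (fun ε : ℝ => ε⁻¹ • (Sfun (perturb n p x i j ε) - Sfun x))
      (nhdsWithin 0 {0}ᶜ) (nhds (H i j)))
    -- Assumption 2: the eigenvalues `s 0 > ⋯ > s (p-1)` of `S(F_n)` are distinct,
    -- with orthonormal eigenvectors `u` and eigenprojections `T ℓ = u ℓ (u ℓ)'`: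
    (u : Fin p → Fin p → ℝ) (s : Fin p → ℝ)
    (hortho : ∀ a b, u a ⬝ᵥ u b = if a = b then (1 : ℝ) else 0)
    (hanti : StrictAnti s)
    (heig : ∀ ℓ, (Sfun x).mulVec (u ℓ) = s ℓ • u ℓ)
    (T : Fin p → Matrix (Fin p) (Fin p) ℝ) (hT : ∀ ℓ, T ℓ = Matrix.vecMulVec (u ℓ) (u ℓ))
    (i : Fin n) (j : Fin p) :
    HasDerivAt
      (fun ε : ℝ => tfun (perturb n p x i j ε)
        + (topProj p k (Sfun (perturb n p x i j ε))).mulVec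
            (x i + ε • (Pi.single j 1 : Fin p → ℝ) - tfun (perturb n p x i j ε)))
      (h i j
        + (∑ ℓ ∈ Finset.univ.filter (fun ℓ : Fin p => (ℓ : ℕ) < k), T ℓ).mulVec
            ((Pi.single j 1 : Fin p → ℝ) - h i j)
        + (∑ a ∈ Finset.univ.filter (fun a : Fin p => (a : ℕ) < k),
            ∑ b ∈ Finset.univ.filter (fun b : Fin p => k ≤ (b : ℕ)),
              (s a - s b)⁻¹ • (T a * H i j * T b + T b * H i j * T a)).mulVec
            (x i - tfun x))
      0 := by
  have hp0 : perturb n p x i j 0 = x := by simp [perturb]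
  have ht (c) : HasDerivAt (fun ε : ℝ => tfun (perturb n p x i j ε) c) (h i j c) 0 :=
    hasDerivAt_of_tendsto_inv_smul (by rw [hp0]) (tendsto_pi_nhds.mp (hA1t i j) c)
  have hS (a b) : HasDerivAt (fun ε : ℝ => Sfun (perturb n p x i j ε) a b) (H i j a b) 0 :=
    hasDerivAt_of_tendsto_inv_smul (by rw [hp0])
      (tendsto_pi_nhds.mp (tendsto_pi_nhds.mp (hA1S i j) a) b)
  obtain ⟨hP0, hP⟩ := hasDerivAt_topProj (k := k)
    (A := fun ε => Sfun (perturb n p x i j ε)) (fun ε => hSsymm _) hS hortho hanti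
    (by simpa only [hp0] using heig)
  simp only [← hT] at hP0 hP
  rw [hasDerivAt_pi]
  intro c
  have hx (d) : HasDerivAt
      (fun ε : ℝ => (x i + ε • (Pi.single j 1 : Fin p → ℝ) - tfun (perturb n p x i j ε)) d)
      (((Pi.single j 1 : Fin p → ℝ) - h i j) d) 0 := by
    have := (((hasDerivAt_id (0 : ℝ)).mul_const
      ((Pi.single j 1 : Fin p → ℝ) d)).const_add (x i d)).fun_sub (ht d)
    rw [one_mul] at this
    exact this
  have hsum := (ht c).fun_add (HasDerivAt.fun_sum (u := Finset.univ) fun d _ =>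
    (hP c d).fun_mul (hx d))
  refine hsum.congr_deriv ?_
  rw [hP0]
  simp only [hp0, zero_smul, add_zero, Finset.sum_add_distrib, Pi.add_apply, Matrix.mulVec,
    dotProduct]
  ring
end
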